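/- arXiv:2305.16459 — 3 statements merged into one kernel-verified Lean document; each statement's English description precedes it below -/
import Mathlib

section
/- Let (Ω, 𝓕, ℙ) be a probability space, 𝓖 ⊆ 𝓕 a sub-σ-algebra, and N, M, V : Ω → ℝ be 𝓖-measurable random variables with E[N] ≠ 0. Let S, S' : Ω → ℝ be random variables such that S, S², S·N, S', S'², S'·N, N, N², N·M, N·V, N²·M, N²·M² are all integrable, and, for a real constant δ, E[S | 𝓖] = N·M, E[S² | 𝓖] = N·V + N²·M², E[S' | 𝓖] = N·(M + δ), and E[S'² | 𝓖] = N·V + N²·(M + δ)², all almost surely. Then h(S', N) = h(S, N), where for a pair (T, N) one sets μ_T = E[T], μ_N = E[N], σ_T² = Var(T), σ_N² = Var(N), σ_TN = Cov(T, N), and h(T, N) = (1/μ_N²)(σ_T² − 2(μ_T/μ_N)σ_TN + (μ_T²/μ_N²)σ_N²). -/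
open MeasureTheory

/-- The Delta-method variance coefficient
`h(T, N) = (1/μ_N²)(σ_T² − 2(μ_T/μ_N)σ_TN + (μ_T²/μ_N²)σ_N²)`,
where `μ_T = E[T]`, `μ_N = E[N]`, `σ_T² = Var T = E[T²] − (E T)²`,
`σ_N² = Var N`, and `σ_TN = Cov(T, N) = E[T·N] − E[T]·E[N]`. -/
noncomputable def deltaCoef {Ω : Type*} [MeasurableSpace Ω] (P : Measure Ω)
    (T N : Ω → ℝ) : ℝ :=
  (1 / (∫ ω, N ω ∂P) ^ 2) *
    (((∫ ω, T ω ^ 2 ∂P) - (∫ ω, T ω ∂P) ^ 2)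
      - 2 * ((∫ ω, T ω ∂P) / (∫ ω, N ω ∂P)) *
          ((∫ ω, T ω * N ω ∂P) - (∫ ω, T ω ∂P) * (∫ ω, N ω ∂P))
      + ((∫ ω, T ω ∂P) ^ 2 / (∫ ω, N ω ∂P) ^ 2) *
          ((∫ ω, N ω ^ 2 ∂P) - (∫ ω, N ω ∂P) ^ 2))

/-- Theorem 1 of the paper: if the treatment has no effect on the count `N` and the
conditional variance `V`, and a constant additive effect `δ` on the conditional
mean `M`, then the Delta-method variance coefficient `h` is the same for
treatment (`S'`) and control (`S`). -/
theorem deltaCoef_invariant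
    {Ω : Type*} [𝓕 : MeasurableSpace Ω] (P : Measure Ω) [IsProbabilityMeasure P]
    (𝓖 : MeasurableSpace Ω) (h𝓖 : 𝓖 ≤ 𝓕)
    (N M V S S' : Ω → ℝ) (δ : ℝ)
    (hN : Measurable[𝓖] N) (hM : Measurable[𝓖] M) (hV : Measurable[𝓖] V)
    (hμN : (∫ ω, N ω ∂P) ≠ 0)
    (hS : Integrable S P)
    (hS2 : Integrable (fun ω => S ω ^ 2) P)
    (hSN : Integrable (fun ω => S ω * N ω) P)
    (hS' : Integrable S' P)
    (hS'2 : Integrable (fun ω => S' ω ^ 2) P)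
    (hS'N : Integrable (fun ω => S' ω * N ω) P)
    (hNint : Integrable N P)
    (hN2 : Integrable (fun ω => N ω ^ 2) P)
    (hNM : Integrable (fun ω => N ω * M ω) P)
    (hNV : Integrable (fun ω => N ω * V ω) P)
    (hN2M : Integrable (fun ω => N ω ^ 2 * M ω) P)
    (hN2M2 : Integrable (fun ω => N ω ^ 2 * M ω ^ 2) P)
    (hcond1 : P[S|𝓖] =ᵐ[P] fun ω => N ω * M ω)
    (hcond2 : P[(fun ω => S ω ^ 2)|𝓖] =ᵐ[P] fun ω => N ω * V ω + N ω ^ 2 * M ω ^ 2)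
    (hcond1' : P[S'|𝓖] =ᵐ[P] fun ω => N ω * (M ω + δ))
    (hcond2' : P[(fun ω => S' ω ^ 2)|𝓖] =ᵐ[P]
      fun ω => N ω * V ω + N ω ^ 2 * (M ω + δ) ^ 2) :
    @deltaCoef Ω 𝓕 P S' N = @deltaCoef Ω 𝓕 P S N := by
  have e1 : ∫ ω, S ω ∂P = ∫ ω, N ω * M ω ∂P := by
    rw [← integral_condExp h𝓖, integral_congr_ae hcond1]
  have e1' : ∫ ω, S' ω ∂P = (∫ ω, N ω * M ω ∂P) + δ * ∫ ω, N ω ∂P := by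
    rw [← integral_condExp h𝓖, integral_congr_ae hcond1', ← integral_const_mul,
      ← integral_add hNM (hNint.const_mul δ)]
    congr 1; ext ω; ring
  have e2 : ∫ ω, S ω ^ 2 ∂P = ∫ ω, N ω * V ω + N ω ^ 2 * M ω ^ 2 ∂P := by
    rw [← integral_condExp h𝓖, integral_congr_ae hcond2]
  have e2' : ∫ ω, S' ω ^ 2 ∂P = (∫ ω, N ω * V ω + N ω ^ 2 * M ω ^ 2 ∂P)
      + ((2 * δ) * (∫ ω, N ω ^ 2 * M ω ∂P) + δ ^ 2 * ∫ ω, N ω ^ 2 ∂P) := by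
    rw [← integral_condExp h𝓖, integral_congr_ae hcond2', ← integral_const_mul,
      ← integral_const_mul, ← integral_add (hN2M.const_mul _) (hN2.const_mul _)]
    refine Eq.trans ?_ (integral_add (hNV.add hN2M2)
      ((hN2M.const_mul (2 * δ)).add (hN2.const_mul (δ ^ 2))))
    congr 1; ext ω; ring
  have key : ∀ T : Ω → ℝ, Integrable T P → Integrable (fun ω => T ω * N ω) P →
      ∫ ω, T ω * N ω ∂P = ∫ ω, N ω * (P[T|𝓖]) ω ∂P := by
    intro T hT hTN
    have hNT : Integrable (N * T) P := by
      refine hTN.congr (Filter.Eventually.of_forall fun ω => ?_)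
      simp [mul_comm]
    have h := condExp_mul_of_stronglyMeasurable_left hN.stronglyMeasurable hNT hT
    calc ∫ ω, T ω * N ω ∂P = ∫ ω, (N * T) ω ∂P := by simp [mul_comm]
      _ = ∫ ω, (P[N * T|𝓖]) ω ∂P := (integral_condExp h𝓖).symm
      _ = ∫ ω, N ω * (P[T|𝓖]) ω ∂P := integral_congr_ae h
  have e3 : ∫ ω, S ω * N ω ∂P = ∫ ω, N ω ^ 2 * M ω ∂P := by
    rw [key S hS hSN]
    refine integral_congr_ae ?_
    filter_upwards [hcond1] with ω h
    rw [h]; ring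
  have e3' : ∫ ω, S' ω * N ω ∂P = (∫ ω, N ω ^ 2 * M ω ∂P) + δ * ∫ ω, N ω ^ 2 ∂P := by
    rw [key S' hS' hS'N, ← integral_const_mul, ← integral_add hN2M (hN2.const_mul δ)]
    refine integral_congr_ae ?_
    filter_upwards [hcond1'] with ω h
    rw [h]; ring
  unfold deltaCoef
  rw [e1, e1', e2, e2', e3, e3']
  field_simp
  ring
end

section
/- Let (Ω, 𝓕, ℙ) be a probability space, 𝓖 ⊆ 𝓕 a sub-σ-algebra, and N, M : Ω → ℝ be 𝓖-measurable random variables with E[N] ≠ 0. Let δ be a real constant and let S, S' : Ω → ℝ be random variables such that S, S², S·N, S', S'², S'·N, N, N², N·M, N·M², N²·M, N²·M² are all integrable, and, almost surely, E[S | 𝓖] = N·M, E[S² | 𝓖] = N·M·(1 − M) + N²·M², E[S' | 𝓖] = N·(M + δ), and E[S'² | 𝓖] = N·(M + δ)·(1 − M − δ) + N²·(M + δ)². Then h(S', N) − h(S, N) = δ·((1 − δ)·μ_N − 2·μ_S)/μ_N², where μ_S = E[S], μ_N = E[N], and for a pair (T, N) one sets μ_T = E[T], σ_T² = Var(T), σ_N²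 = Var(N), σ_TN = Cov(T, N), and h(T, N) = (1/μ_N²)(σ_T² − 2(μ_T/μ_N)σ_TN + (μ_T²/μ_N²)σ_N²). -/
open MeasureTheory

theorem aux_moments {Ω : Type*} [𝓕 : MeasurableSpace Ω] (P : Measure Ω) [IsProbabilityMeasure P]
    (𝓖 : MeasurableSpace Ω) (h𝓖 : 𝓖 ≤ 𝓕)
    (N M T : Ω → ℝ) (d : ℝ)
    (hN : Measurable[𝓖] N)
    (hT : Integrable T P)
    (hTN : Integrable (fun ω => T ω * N ω) P)
    (hNint : Integrable N P)
    (hN2 : Integrable (fun ω => N ω ^ 2) P)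
    (hNM : Integrable (fun ω => N ω * M ω) P)
    (hNM2 : Integrable (fun ω => N ω * M ω ^ 2) P)
    (hN2M : Integrable (fun ω => N ω ^ 2 * M ω) P)
    (hN2M2 : Integrable (fun ω => N ω ^ 2 * M ω ^ 2) P)
    (hcond1 : P[T|𝓖] =ᵐ[P] fun ω => N ω * (M ω + d))
    (hcond2 : P[(fun ω => T ω ^ 2)|𝓖] =ᵐ[P]
      fun ω => N ω * (M ω + d) * (1 - M ω - d) + N ω ^ 2 * (M ω + d) ^ 2) :
    (∫ ω, T ω ∂P) = (∫ ω, N ω * M ω ∂P) + d * (∫ ω, N ω ∂P) ∧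
    (∫ ω, T ω * N ω ∂P) = (∫ ω, N ω ^ 2 * M ω ∂P) + d * (∫ ω, N ω ^ 2 ∂P) ∧
    (∫ ω, T ω ^ 2 ∂P) = (1 - 2 * d) * (∫ ω, N ω * M ω ∂P) + (d - d ^ 2) * (∫ ω, N ω ∂P)
      + (-1) * (∫ ω, N ω * M ω ^ 2 ∂P) + (∫ ω, N ω ^ 2 * M ω ^ 2 ∂P)
      + 2 * d * (∫ ω, N ω ^ 2 * M ω ∂P) + d ^ 2 * (∫ ω, N ω ^ 2 ∂P) := by
  refine ⟨?_, ?_, ?_⟩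
  · rw [← integral_condExp h𝓖, integral_congr_ae hcond1, ← integral_const_mul,
      ← integral_add hNM (hNint.const_mul d)]
    congr 1; ext ω; ring
  · have h := condExp_mul_of_stronglyMeasurable_right (μ := P) (f := T)
      hN.stronglyMeasurable hTN hT
    have h2 : P[(fun ω => T ω * N ω)|𝓖] =ᵐ[P] fun ω => N ω ^ 2 * M ω + d * N ω ^ 2 := by
      refine h.trans ?_
      filter_upwards [hcond1] with ω hω
      simp only [Pi.mul_apply, hω]; ring
    rw [← integral_condExp h𝓖, integral_congr_ae h2, integral_add hN2M (hN2.const_mul d),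
      integral_const_mul]
  · rw [← integral_condExp h𝓖, integral_congr_ae hcond2]
    simp only [← integral_const_mul]
    have i1 := hNM.const_mul (1 - 2 * d)
    have i2 := hNint.const_mul (d - d ^ 2)
    have i3 := hNM2.const_mul (-1)
    have i5 := hN2M.const_mul (2 * d)
    have i6 := hN2.const_mul (d ^ 2)
    have j2 : Integrable (fun x => (1 - 2 * d) * (N x * M x) + (d - d ^ 2) * N x) P := i1.add i2
    have j3 : Integrable (fun x => (1 - 2 * d) * (N x * M x) + (d - d ^ 2) * N x
      + -1 * (N x * M x ^ 2)) P := j2.add i3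
    have j4 : Integrable (fun x => (1 - 2 * d) * (N x * M x) + (d - d ^ 2) * N x
      + -1 * (N x * M x ^ 2) + N x ^ 2 * M x ^ 2) P := j3.add hN2M2
    have j5 : Integrable (fun x => (1 - 2 * d) * (N x * M x) + (d - d ^ 2) * N x
      + -1 * (N x * M x ^ 2) + N x ^ 2 * M x ^ 2 + 2 * d * (N x ^ 2 * M x)) P := j4.add i5
    rw [← integral_add i1 i2, ← integral_add j2 i3, ← integral_add j3 hN2M2,
      ← integral_add j4 i5, ← integral_add j5 i6]
    congr 1; ext ω; ring

/-- Theorem 2 of the paper: for Bernoulli observations (conditional per-observation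
variance `M(1 − M)`), if the treatment has no effect on the count `N` and a constant
additive effect `δ` on the success probability `M`, then the difference in the
Delta-method variance coefficient `h` between treatment (`S'`) and control (`S`) is
`δ·((1 − δ)·μ_N − 2·μ_S)/μ_N²`. -/
theorem deltaCoef_diff_bernoulli
    {Ω : Type*} [𝓕 : MeasurableSpace Ω] (P : Measure Ω) [IsProbabilityMeasure P]
    (𝓖 : MeasurableSpace Ω) (h𝓖 : 𝓖 ≤ 𝓕)
    (N M S S' : Ω → ℝ) (δ : ℝ)
    (hN : Measurable[𝓖] N) (hM : Measurable[𝓖] M)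
    (hμN : (∫ ω, N ω ∂P) ≠ 0)
    (hS : Integrable S P)
    (hS2 : Integrable (fun ω => S ω ^ 2) P)
    (hSN : Integrable (fun ω => S ω * N ω) P)
    (hS' : Integrable S' P)
    (hS'2 : Integrable (fun ω => S' ω ^ 2) P)
    (hS'N : Integrable (fun ω => S' ω * N ω) P)
    (hNint : Integrable N P)
    (hN2 : Integrable (fun ω => N ω ^ 2) P)
    (hNM : Integrable (fun ω => N ω * M ω) P)
    (hNM2 : Integrable (fun ω => N ω * M ω ^ 2) P)
    (hN2M : Integrable (fun ω => N ω ^ 2 * M ω) P)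
    (hN2M2 : Integrable (fun ω => N ω ^ 2 * M ω ^ 2) P)
    (hcond1 : P[S|𝓖] =ᵐ[P] fun ω => N ω * M ω)
    (hcond2 : P[(fun ω => S ω ^ 2)|𝓖] =ᵐ[P]
      fun ω => N ω * M ω * (1 - M ω) + N ω ^ 2 * M ω ^ 2)
    (hcond1' : P[S'|𝓖] =ᵐ[P] fun ω => N ω * (M ω + δ))
    (hcond2' : P[(fun ω => S' ω ^ 2)|𝓖] =ᵐ[P]
      fun ω => N ω * (M ω + δ) * (1 - M ω - δ) + N ω ^ 2 * (M ω + δ) ^ 2) :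
    @deltaCoef Ω 𝓕 P S' N - @deltaCoef Ω 𝓕 P S N =
      δ * ((1 - δ) * (∫ ω, N ω ∂P) - 2 * (∫ ω, S ω ∂P)) / (∫ ω, N ω ∂P) ^ 2 := by
  obtain ⟨a1, a2, a3⟩ := aux_moments (𝓕 := 𝓕) P 𝓖 h𝓖 N M S' δ hN hS' hS'N hNint hN2 hNM hNM2 hN2M hN2M2
    hcond1' hcond2'
  obtain ⟨b1, b2, b3⟩ := aux_moments (𝓕 := 𝓕) P 𝓖 h𝓖 N M S 0 hN hS hSN hNint hN2 hNM hNM2 hN2M hN2M2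
    (by simpa using hcond1) (by simpa using hcond2)
  unfold deltaCoef
  rw [a1, a2, a3, b1, b2, b3]
  field_simp
  ring
end

section
/- Let (Ω, 𝓕, ℙ) be a probability space, 𝓖 ⊆ 𝓕 a sub-σ-algebra, N, M, V : Ω → ℝ be 𝓖-measurable random variables, and δ a real constant. Let S, S' : Ω → ℝ be random variables with S, S², S·N, S', S'², S'·N, N, N², N·M, N·V, N²·M, N²·M² integrable, such that, almost surely, E[S | 𝓖] = N·M, E[S² | 𝓖] = N·V + N²·M², E[S' | 𝓖] = N·(M + δ), and E[S'² | 𝓖] = N·V + N²·(M + δ)². Then Var(S') = Var(S) + 2δ·Cov(S, N) + δ²·Var(N). -/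
open MeasureTheory

/-- Update of the variance of the per-user sum under a constant additive treatment
effect `δ` on the conditional mean (no effect on the count `N` or the conditional
variance `V`): `Var(S') = Var(S) + 2δ·Cov(S, N) + δ²·Var(N)`. -/
theorem variance_update
    {Ω : Type*} [𝓕 : MeasurableSpace Ω] (P : Measure Ω) [IsProbabilityMeasure P]
    (𝓖 : MeasurableSpace Ω) (h𝓖 : 𝓖 ≤ 𝓕)
    (N M V S S' : Ω → ℝ) (δ : ℝ)
    (hN : Measurable[𝓖] N) (hM : Measurable[𝓖] M) (hV : Measurable[𝓖] V)
    (hS : Integrable S P)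
    (hS2 : Integrable (fun ω => S ω ^ 2) P)
    (hSN : Integrable (fun ω => S ω * N ω) P)
    (hS' : Integrable S' P)
    (hS'2 : Integrable (fun ω => S' ω ^ 2) P)
    (hS'N : Integrable (fun ω => S' ω * N ω) P)
    (hNint : Integrable N P)
    (hN2 : Integrable (fun ω => N ω ^ 2) P)
    (hNM : Integrable (fun ω => N ω * M ω) P)
    (hNV : Integrable (fun ω => N ω * V ω) P)
    (hN2M : Integrable (fun ω => N ω ^ 2 * M ω) P)
    (hN2M2 : Integrable (fun ω => N ω ^ 2 * M ω ^ 2) P)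
    (hcond1 : P[S|𝓖] =ᵐ[P] fun ω => N ω * M ω)
    (hcond2 : P[(fun ω => S ω ^ 2)|𝓖] =ᵐ[P] fun ω => N ω * V ω + N ω ^ 2 * M ω ^ 2)
    (hcond1' : P[S'|𝓖] =ᵐ[P] fun ω => N ω * (M ω + δ))
    (hcond2' : P[(fun ω => S' ω ^ 2)|𝓖] =ᵐ[P]
      fun ω => N ω * V ω + N ω ^ 2 * (M ω + δ) ^ 2) :
    (∫ ω, S' ω ^ 2 ∂P) - (∫ ω, S' ω ∂P) ^ 2 =
      ((∫ ω, S ω ^ 2 ∂P) - (∫ ω, S ω ∂P) ^ 2)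
        + 2 * δ * ((∫ ω, S ω * N ω ∂P) - (∫ ω, S ω ∂P) * (∫ ω, N ω ∂P))
        + δ ^ 2 * ((∫ ω, N ω ^ 2 ∂P) - (∫ ω, N ω ∂P) ^ 2) := by
  have e1 : ∫ ω, S ω ∂P = ∫ ω, N ω * M ω ∂P := by
    rw [← integral_condExp h𝓖, integral_congr_ae hcond1]
  have e2 : ∫ ω, S ω ^ 2 ∂P = (∫ ω, N ω * V ω ∂P) + ∫ ω, N ω ^ 2 * M ω ^ 2 ∂P := by
    rw [← integral_condExp h𝓖, integral_congr_ae hcond2, integral_add hNV hN2M2]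
  have e3 : ∫ ω, S' ω ∂P = (∫ ω, N ω * M ω ∂P) + δ * ∫ ω, N ω ∂P := by
    rw [← integral_condExp h𝓖, integral_congr_ae hcond1', ← integral_const_mul,
      ← integral_add hNM (hNint.const_mul δ)]
    congr 1
    ext ω
    ring
  have e4 : ∫ ω, S' ω ^ 2 ∂P = ((∫ ω, N ω * V ω ∂P) + ∫ ω, N ω ^ 2 * M ω ^ 2 ∂P)
      + ((2 * δ) * (∫ ω, N ω ^ 2 * M ω ∂P) + δ ^ 2 * ∫ ω, N ω ^ 2 ∂P) := by
    rw [← integral_condExp h𝓖, integral_congr_ae hcond2', ← integral_const_mul,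
      ← integral_const_mul, ← integral_add hNV hN2M2,
      ← integral_add (hN2M.const_mul (2 * δ)) (hN2.const_mul (δ ^ 2))]
    refine Eq.trans ?_ (integral_add (hNV.add hN2M2)
      ((hN2M.const_mul (2 * δ)).add (hN2.const_mul (δ ^ 2))))
    congr 1
    ext ω
    ring
  have e5 : ∫ ω, S ω * N ω ∂P = ∫ ω, N ω ^ 2 * M ω ∂P := by
    have h : P[S * N|𝓖] =ᵐ[P] P[S|𝓖] * N :=
      condExp_mul_of_stronglyMeasurable_right hN.stronglyMeasurable hSN hS
    have h2 : P[fun ω => S ω * N ω|𝓖] =ᵐ[P] fun ω => N ω ^ 2 * M ω := by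
      filter_upwards [h, hcond1] with ω a b
      change (P[S * N|𝓖]) ω = _
      rw [a, Pi.mul_apply, b]
      ring
    rw [← integral_condExp h𝓖, integral_congr_ae h2]
  rw [e1, e2, e3, e4, e5]
  ring
end
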